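/- Let 1 < ρ < ∞ with conjugate exponent ϱ (1/ρ + 1/ϱ = 1). For all nonnegative integers m, k, q', every row vector h ∈ M_{n,n}(0,1;F) and every A ∈ M_{n,n'}(m+k,q';F), the matrix ((h^{(m)}/m!)⊙E_k)·A ∈ M_{n,n'}(k,q';F) satisfies ‖((h^{(m)}/m!)⊙E_k)A‖_ρ ≤ binom(m+k,k)·‖h‖_ϱ^m·‖A‖_ρ, where ‖h‖_ϱ = (Σ_i |h_i|^ϱ)^{1/ϱ} and E_k ∈ M_{n,n}(k,k;F) is the unit matrix. -/

import Mathlib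

open scoped BigOperators ENNReal

noncomputable section

/-- The degree `|α|` of a multi-index `α ∈ ℕ^n`. -/
def mdeg {n : ℕ} (α : Fin n → ℕ) : ℕ := ∑ i, α i

/-- The factorial `α! = α₁! ⋯ αₙ!` of a multi-index. -/
def mfact {n : ℕ} (α : Fin n → ℕ) : ℕ := ∏ i, (α i).factorial

/-- The multi-indices in `ℕ^n` of degree `p`. -/
abbrev MIdx (n p : ℕ) := {α : Fin n → ℕ // mdeg α = p}

instance (n p : ℕ) : Fintype (MIdx n p) :=
  Fintype.subtype (Finset.Nat.antidiagonalTuple n p) (fun α => by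
    simp [Finset.Nat.mem_antidiagonalTuple, mdeg])

/-- The space `M(p,p';F)` of matrices with rows indexed by degree-`p` multi-indices in `ℕ^n`
and columns indexed by degree-`p'` multi-indices in `ℕ^n'`. -/
abbrev MMat (n n' p p' : ℕ) (F : Type*) := MIdx n p → MIdx n' p' → F

lemma mdeg_sub {n p q : ℕ} (α : MIdx n (p + q)) (β : MIdx n p) (h : ∀ i, β.1 i ≤ α.1 i) :
    mdeg (α.1 - β.1) = q := by
  have h1 : mdeg (α.1 - β.1) + mdeg β.1 = mdeg α.1 := by
    simp only [mdeg, ← Finset.sum_add_distrib]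
    exact Finset.sum_congr rfl fun i _ => Nat.sub_add_cancel (h i)
  have h2 := α.2
  have h3 := β.2
  omega

/-- The product `⊙` of `A ∈ M(p,p';F)` and `B ∈ M(q,q';F)`:
`(A⊙B)_{α,α'} = Σ_{β≤α, β'≤α', |β|=p, |β'|=p'} (α!/(β!(α−β)!)) A_{β,β'} B_{α−β,α'−β'}`. -/
def oprod {n n' p p' q q' : ℕ} {F : Type*} [RCLike F]
    (A : MMat n n' p p' F) (B : MMat n n' q q' F) : MMat n n' (p + q) (p' + q') F :=
  fun α α' =>
    ∑ β : MIdx n p, ∑ β' : MIdx n' p',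
      if h : (∀ i, β.1 i ≤ α.1 i) ∧ (∀ j, β'.1 j ≤ α'.1 j) then
        ((mfact α.1 : F) / ((mfact β.1 : F) * (mfact (α.1 - β.1) : F))) * A β β' *
          B ⟨α.1 - β.1, mdeg_sub α β h.1⟩ ⟨α'.1 - β'.1, mdeg_sub α' β' h.2⟩
      else 0

/-- Change the degree parameter of a multi-index along an equality of natural numbers. -/
def recast {n a b : ℕ} (h : a = b) (α : MIdx n a) : MIdx n b := ⟨α.1, h ▸ α.2⟩

/-- The ordinary matrix product. -/
def mmul {n n' p q q' : ℕ} {F : Type*} [RCLike F]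
    (A : MMat n n p q F) (B : MMat n n' q q' F) : MMat n n' p q' F :=
  fun α α' => ∑ β : MIdx n q, A α β * B β α'

/-- The `m`-th `⊙`-power of a row `h ∈ M(0,1;F)`. -/
def opowRow {n : ℕ} {F : Type*} [RCLike F] (h : MMat n n 0 1 F) : (m : ℕ) → MMat n n 0 m F
  | 0 => fun _ _ => 1
  | m + 1 => fun z α => oprod h (opowRow h m) z (recast (Nat.add_comm m 1) α)

/-- The `m`-th `⊙`-power of a column `v ∈ M(1,0;F)`. -/
def opowCol {n : ℕ} {F : Type*} [RCLike F] (v : MMat n n 1 0 F) : (m : ℕ) → MMat n n m 0 F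
  | 0 => fun _ _ => 1
  | m + 1 => fun α z => oprod v (opowCol v m) (recast (Nat.add_comm m 1) α) z

/-- The `⊙`-product `h¹ ⊙ h² ⊙ ⋯ ⊙ hᵐ` of a family of rows `hⁱ ∈ M(0,1;F)`. -/
def oprodRowFamily {n : ℕ} {F : Type*} [RCLike F] :
    (m : ℕ) → (Fin m → MMat n n 0 1 F) → MMat n n 0 m F
  | 0, _ => fun _ _ => 1
  | m + 1, hs => fun z α =>
      oprod (hs 0) (oprodRowFamily m fun i => hs i.succ) z (recast (Nat.add_comm m 1) α)

/-- The row vector `(h₁,…,hₙ) ∈ M(0,1;F)` determined by `h : Fin n → F`; its entry at the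
degree-one column index `α'` is `h^{α'}`. -/
def rowOf {n : ℕ} {F : Type*} [RCLike F] (h : Fin n → F) : MMat n n 0 1 F :=
  fun _ α' => ∏ i, h i ^ α'.1 i

/-- The column vector `(v₁,…,vₙ) ∈ M(1,0;F)` determined by `v : Fin n → F`. -/
def colOf {n : ℕ} {F : Type*} [RCLike F] (v : Fin n → F) : MMat n n 1 0 F :=
  fun α _ => ∏ i, v i ^ α.1 i

/-- The unit matrix `E_k ∈ M_{n,n}(k,k;F)`. -/
def unitMat (n k : ℕ) (F : Type*) [RCLike F] : MMat n n k k F :=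
  fun α β => if α = β then 1 else 0

/-- The `ρ`-norm `‖A‖_ρ = (Σ_{α,α'} |A_{α,α'}|^ρ/(α!(p!p'!)^{ρ−1}))^{1/ρ}` on `M(p,p';F)`. -/
def rnorm {n n' p p' : ℕ} {F : Type*} [RCLike F] (ρ : ℝ) (A : MMat n n' p p' F) : ℝ :=
  (∑ α : MIdx n p, ∑ α' : MIdx n' p',
      ‖A α α'‖ ^ ρ /
        ((mfact α.1 : ℝ) * ((p.factorial * p'.factorial : ℕ) : ℝ) ^ (ρ - 1))) ^ (1 / ρ)

/-- The `∞`-norm `‖A‖_∞ = sup_{α,α'} |A_{α,α'}| / (p!p'!)` on `M(p,p';F)`. -/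
def rnormInf {n n' p p' : ℕ} {F : Type*} [RCLike F] (A : MMat n n' p p' F) : ℝ :=
  (⨆ x : MIdx n p × MIdx n' p', ‖A x.1 x.2‖) / ((p.factorial * p'.factorial : ℕ) : ℝ)

/-- The `σ`-norm of a vector in `F^n`, for a real exponent `σ`. -/
def vnorm {n : ℕ} {F : Type*} [RCLike F] (σ : ℝ) (h : Fin n → F) : ℝ :=
  (∑ i, ‖h i‖ ^ σ) ^ (1 / σ)

/-- The `σ`-norm of a vector in `F^n`, for an extended real exponent `σ`
(`= max_i |h_i|` when `σ = ∞`). -/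
def vnormE {n : ℕ} {F : Type*} [RCLike F] (σ : ℝ≥0∞) (h : Fin n → F) : ℝ :=
  if σ = ∞ then ⨆ i, ‖h i‖ else (∑ i, ‖h i‖ ^ σ.toReal) ^ (1 / σ.toReal)

/-- Absolute convergence of the power series `Σ_m x^{(m)}/m!·A(m)` at the point `h ∈ F^n`:
for every column index `α'` of degree `q'`, the family `|h^α/α! · A(|α|)_{α,α'}|`, indexed by
all multi-indices `α ∈ ℕ^n`, is summable. -/
def AbsConvAt {n n' q' : ℕ} {F : Type*} [RCLike F]
    (A : (m : ℕ) → MMat n n' m q' F) (h : Fin n → F) : Prop :=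
  ∀ α' : MIdx n' q', Summable fun α : Fin n → ℕ =>
    ‖(∏ i, h i ^ α i) / (mfact α : F) * A (mdeg α) ⟨α, rfl⟩ α'‖

/-- `r = limsup_m ‖A(m)‖_ρ^{1/m}`, the reciprocal of the radius of convergence,
computed in `ℝ≥0∞`. -/
def convRadiusInv {n n' q' : ℕ} {F : Type*} [RCLike F] (ρ : ℝ)
    (A : (m : ℕ) → MMat n n' m q' F) : ℝ≥0∞ :=
  Filter.atTop.limsup fun m : ℕ => ENNReal.ofReal (rnorm ρ (A m)) ^ (1 / (m : ℝ))

/-- `r = limsup_m ‖A(m)‖_∞^{1/m}` computed in `ℝ≥0∞`. -/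
def convRadiusInvInf {n n' q' : ℕ} {F : Type*} [RCLike F]
    (A : (m : ℕ) → MMat n n' m q' F) : ℝ≥0∞ :=
  Filter.atTop.limsup fun m : ℕ => ENNReal.ofReal (rnormInf (A m)) ^ (1 / (m : ℝ))

lemma sum_midx {n p : ℕ} {M : Type*} [AddCommMonoid M] (f : (Fin n → ℕ) → M) :
    ∑ α : MIdx n p, f α.1 = ∑ α ∈ Finset.univ.piAntidiag p, f α :=
  (Finset.sum_subtype _ (fun α => by simp [mdeg]) f).symm

lemma sum_piAntidiag_prod_choose {ι : Type*} [DecidableEq ι] (s : Finset ι) (δ : ι → ℕ) (p : ℕ) :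
    ∑ α ∈ s.piAntidiag p, ∏ i ∈ s, (δ i).choose (α i) = (∑ i ∈ s, δ i).choose p := by
  induction s using Finset.cons_induction generalizing p with
  | empty => cases p <;> simp
  | cons a s ha ih =>
    rw [Finset.piAntidiag_cons ha, Finset.sum_disjiUnion, Finset.sum_cons, Nat.add_choose_eq]
    refine Finset.sum_congr rfl fun x _ => ?_
    rw [Finset.sum_map, ← ih, Finset.mul_sum]
    refine Finset.sum_congr rfl fun α hα => ?_
    have hαa : α a = 0 := by
      by_contra h
      exact ha ((Finset.mem_piAntidiag.1 hα).2 a h)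
    rw [Finset.prod_cons]
    congr 1
    · simp [hαa]
    · refine Finset.prod_congr rfl fun i hi => ?_
      have : i ≠ a := fun h => ha (h ▸ hi)
      simp [this]

lemma sum_midx_prod_choose {n p : ℕ} (δ : Fin n → ℕ) :
    ∑ α : MIdx n p, ∏ i, (δ i).choose (α.1 i) = (mdeg δ).choose p := by
  rw [sum_midx fun α => ∏ i, (δ i).choose (α i)]
  exact sum_piAntidiag_prod_choose _ _ _

lemma mfact_pos {n : ℕ} (α : Fin n → ℕ) : 0 < mfact α :=
  Finset.prod_pos fun _ _ => Nat.factorial_pos _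

lemma mfact_ne_zero {n : ℕ} {K : Type*} [Semiring K] [CharZero K] (α : Fin n → ℕ) :
    (mfact α : K) ≠ 0 := Nat.cast_ne_zero.2 (mfact_pos α).ne'

lemma prod_choose_eq_zero {n : ℕ} {α δ : Fin n → ℕ} (h : ¬ ∀ i, α i ≤ δ i) :
    ∏ i, (δ i).choose (α i) = 0 := by
  push Not at h
  obtain ⟨i, hi⟩ := h
  exact Finset.prod_eq_zero (Finset.mem_univ i) (Nat.choose_eq_zero_of_lt hi)

lemma prod_choose_mul_mfact {n : ℕ} {α δ : Fin n → ℕ} (h : ∀ i, α i ≤ δ i) :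
    (∏ i, (δ i).choose (α i)) * mfact α * mfact (δ - α) = mfact δ := by
  simp only [mfact, ← Finset.prod_mul_distrib]
  exact Finset.prod_congr rfl fun i _ => Nat.choose_mul_factorial_mul_factorial (h i)

lemma mfact_eq_one_of_mdeg_le_one {n : ℕ} {α : Fin n → ℕ} (h : mdeg α ≤ 1) : mfact α = 1 := by
  have h1 : mfact α ∣ (mdeg α).factorial := Nat.prod_factorial_dvd_factorial_sum _ _
  rw [Nat.factorial_eq_one.2 h] at h1
  exact Nat.dvd_one.1 h1

/-- The multinomial theorem in multi-index form. -/
lemma sum_midx_pow_div_mfact {n m : ℕ} (x : Fin n → ℝ) :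
    ∑ γ : MIdx n m, (∏ i, x i ^ γ.1 i) / (mfact γ.1 : ℝ) = (∑ i, x i) ^ m / (m.factorial : ℝ) := by
  rw [sum_midx fun γ => (∏ i, x i ^ γ i) / (mfact γ : ℝ), Finset.sum_pow_eq_sum_piAntidiag,
    Finset.sum_div]
  refine Finset.sum_congr rfl fun γ hγ => ?_
  have h1 := Nat.multinomial_spec Finset.univ γ
  rw [(Finset.mem_piAntidiag.1 hγ).1] at h1
  rw [← h1, Nat.cast_mul]
  have h2 : (Nat.multinomial Finset.univ γ : ℝ) ≠ 0 :=
    Nat.cast_ne_zero.2 (Nat.multinomial_pos _ _).ne'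
  have h3 := mfact_ne_zero (K := ℝ) γ
  change _ = _ / ((mfact γ : ℝ) * _)
  field_simp

instance (n : ℕ) : Unique (MIdx n 0) where
  default := ⟨0, by simp [mdeg]⟩
  uniq α := Subtype.ext (funext fun i => by
    have := α.2
    simp only [mdeg, Finset.sum_eq_zero_iff] at this
    exact this i (Finset.mem_univ i))

lemma prod_pow_mul_prod_pow_sub {n : ℕ} {F : Type*} [CommMonoid F] (h : Fin n → F)
    {β γ : Fin n → ℕ} (hβ : ∀ i, β i ≤ γ i) :
    (∏ i, h i ^ β i) * ∏ i, h i ^ (γ - β) i = ∏ i, h i ^ γ i := by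
  rw [← Finset.prod_mul_distrib]
  refine Finset.prod_congr rfl fun i _ => ?_
  rw [Pi.sub_apply, ← pow_add, Nat.add_sub_cancel' (hβ i)]

lemma opowRow_rowOf {n m : ℕ} {F : Type*} [RCLike F] (h : Fin n → F) (z : MIdx n 0)
    (γ : MIdx n m) :
    opowRow (rowOf h) m z γ = (m.factorial : F) * (∏ i, h i ^ γ.1 i) / (mfact γ.1 : F) := by
  induction m generalizing z with
  | zero =>
    obtain rfl : γ = default := Subsingleton.elim _ _
    simp [opowRow, default, mfact]
  | succ m ih =>
    have hz : mfact z.1 = 1 := mfact_eq_one_of_mdeg_le_one (z.2.le.trans zero_le_one)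
    have hterm : ∀ β : MIdx n 1,
        (if h' : (∀ i, (default : MIdx n 0).1 i ≤ z.1 i) ∧
            (∀ j, β.1 j ≤ (recast (Nat.add_comm m 1) γ).1 j) then
          ((mfact z.1 : F) / ((mfact (default : MIdx n 0).1 : F) *
            (mfact (z.1 - (default : MIdx n 0).1) : F))) * rowOf h default β *
            opowRow (rowOf h) m ⟨z.1 - (default : MIdx n 0).1, mdeg_sub (p := 0) (q := 0) z default h'.1⟩
              ⟨(recast (Nat.add_comm m 1) γ).1 - β.1, mdeg_sub (recast (Nat.add_comm m 1) γ) β h'.2⟩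
        else 0) = (m.factorial : F) * (∏ i, h i ^ γ.1 i) / (mfact γ.1 : F) *
          ((∏ i, (γ.1 i).choose (β.1 i) : ℕ) : F) := by
      intro β
      have hβ1 := mfact_eq_one_of_mdeg_le_one β.2.le
      have hz0 : z.1 - (default : MIdx n 0).1 = z.1 := by funext i; simp [default]
      split_ifs with h'
      · rw [ih]
        have h1 := prod_choose_mul_mfact h'.2
        have h2 := prod_pow_mul_prod_pow_sub h h'.2
        simp only [recast] at h1 h2 ⊢
        rw [← h2, ← h1, hβ1, hz0, hz]
        have h3 := mfact_ne_zero (K := F) (γ.1 - β.1)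
        have h4 : ((∏ i, (γ.1 i).choose (β.1 i) : ℕ) : F) ≠ 0 :=
          Nat.cast_ne_zero.2 (Finset.prod_pos fun i _ => Nat.choose_pos (h'.2 i)).ne'
        simp only [rowOf, default, mfact] at h3 ⊢
        simp only [Nat.cast_mul, mul_one]
        field_simp
        simp
      · have : ¬ ∀ i, β.1 i ≤ γ.1 i := fun h1 => h' ⟨fun i => by simp [default], h1⟩
        rw [prod_choose_eq_zero this]
        simp
    refine (Fintype.sum_unique (ι := MIdx n 0) _).trans ?_
    rw [Finset.sum_congr rfl fun β _ => hterm β,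
      ← Finset.mul_sum, ← Nat.cast_sum, sum_midx_prod_choose, γ.2, Nat.choose_one_right,
      Nat.factorial_succ, Nat.cast_mul]
    ring

lemma mdeg_sub_of_le {n : ℕ} {α δ : Fin n → ℕ} (h : ∀ i, α i ≤ δ i) :
    mdeg (δ - α) = mdeg δ - mdeg α :=
  Finset.sum_tsub_distrib _ fun i _ => h i

lemma oprod_opowRow_unitMat {n m k : ℕ} {F : Type*} [RCLike F] (h : Fin n → F)
    (α : MIdx n (0 + k)) (δ : MIdx n (m + k)) :
    oprod (fun (z : MIdx n 0) (γ : MIdx n m) =>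
        opowRow (rowOf h) m z γ / (m.factorial : F)) (unitMat n k F) α δ =
      if ∀ i, α.1 i ≤ δ.1 i then (∏ i, h i ^ (δ.1 - α.1) i) / (mfact (δ.1 - α.1) : F) else 0 := by
  have hα0 : α.1 - (default : MIdx n 0).1 = α.1 := by funext i; simp [default]
  have hfact : (mfact α.1 : F) / ((mfact (default : MIdx n 0).1 : F) *
      (mfact (α.1 - (default : MIdx n 0).1) : F)) = 1 := by
    have h1 : mfact (default : MIdx n 0).1 = 1 := by simp [default, mfact]
    rw [hα0, h1, Nat.cast_one, one_mul, div_self (mfact_ne_zero _)]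
  have hm : (m.factorial : F) ≠ 0 := Nat.cast_ne_zero.2 m.factorial_ne_zero
  rw [oprod, Fintype.sum_unique]
  split_ifs with hle
  · have hdeg : mdeg (δ.1 - α.1) = m := by
      rw [mdeg_sub_of_le hle, δ.2, α.2]
      omega
    rw [Fintype.sum_eq_single ⟨δ.1 - α.1, hdeg⟩]
    · have hc : (∀ i, (default : MIdx n 0).1 i ≤ α.1 i) ∧ ∀ i, (δ.1 - α.1) i ≤ δ.1 i :=
        ⟨fun i => by simp [default], fun i => by simp⟩
      rw [dif_pos hc, hfact, opowRow_rowOf, unitMat, if_pos]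
      · field_simp
      · refine Subtype.ext (funext fun i => ?_)
        have := hle i
        have hd : (default : MIdx n 0).1 i = 0 := rfl
        simp only [Pi.sub_apply]
        omega
    · intro β hβ
      split_ifs with hc
      · rw [unitMat, if_neg, mul_zero]
        intro he
        refine hβ (Subtype.ext (funext fun i => ?_))
        have h1 := congrFun (congrArg Subtype.val he) i
        have h2 := hc.2 i
        have hd : (default : MIdx n 0).1 i = 0 := rfl
        simp only [Pi.sub_apply] at h1 ⊢
        omega
      · rfl
  · refine Finset.sum_eq_zero fun β _ => ?_
    split_ifs with hc
    · rw [unitMat, if_neg, mul_zero]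
      intro he
      refine hle fun i => ?_
      have h1 := congrFun (congrArg Subtype.val he) i
      have h2 := hc.2 i
      have hd : (default : MIdx n 0).1 i = 0 := rfl
      simp only [Pi.sub_apply] at h1
      omega
    · rfl

/-- Hölder's inequality with weights, raised to the power `p`. -/
lemma rpow_sum_weight_mul_le {ι : Type*} (s : Finset ι) {p q : ℝ} (hpq : p.HolderConjugate q)
    {w x y : ι → ℝ} (hw : ∀ i ∈ s, 0 ≤ w i) (hx : ∀ i ∈ s, 0 ≤ x i) (hy : ∀ i ∈ s, 0 ≤ y i) :
    (∑ i ∈ s, w i * (x i * y i)) ^ p ≤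
      (∑ i ∈ s, w i * x i ^ q) ^ (p - 1) * ∑ i ∈ s, w i * y i ^ p := by
  have hp := hpq.pos
  have hq := hpq.symm.pos
  have hsum : ∑ i ∈ s, w i * (x i * y i) =
      ∑ i ∈ s, (w i ^ (1 / p) * y i) * (w i ^ (1 / q) * x i) := by
    refine Finset.sum_congr rfl fun i hi => ?_
    have : w i = w i ^ (1 / p) * w i ^ (1 / q) := by
      rw [← Real.rpow_add' (hw i hi), one_div, one_div, hpq.inv_add_inv_eq_one, Real.rpow_one]
      rw [one_div, one_div, hpq.inv_add_inv_eq_one]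
      exact one_ne_zero
    nth_rewrite 1 [this]
    ring
  have hpow : ∀ {r : ℝ} {z : ι → ℝ}, 0 < r → (∀ i ∈ s, 0 ≤ z i) →
      ∑ i ∈ s, (w i ^ (1 / r) * z i) ^ r = ∑ i ∈ s, w i * z i ^ r := by
    intro r z hr hz
    refine Finset.sum_congr rfl fun i hi => ?_
    rw [Real.mul_rpow (Real.rpow_nonneg (hw i hi) _) (hz i hi), ← Real.rpow_mul (hw i hi),
      one_div_mul_cancel hr.ne', Real.rpow_one]
  have hX : 0 ≤ ∑ i ∈ s, w i * x i ^ q :=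
    Finset.sum_nonneg fun i hi => mul_nonneg (hw i hi) (Real.rpow_nonneg (hx i hi) _)
  have hY : 0 ≤ ∑ i ∈ s, w i * y i ^ p :=
    Finset.sum_nonneg fun i hi => mul_nonneg (hw i hi) (Real.rpow_nonneg (hy i hi) _)
  have key := Real.inner_le_Lp_mul_Lq_of_nonneg s hpq
    (fun i hi => mul_nonneg (Real.rpow_nonneg (hw i hi) (1 / p)) (hy i hi))
    (fun i hi => mul_nonneg (Real.rpow_nonneg (hw i hi) (1 / q)) (hx i hi))
  rw [← hsum, hpow hp hy, hpow hq hx] at key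
  have hnn : 0 ≤ ∑ i ∈ s, w i * (x i * y i) :=
    Finset.sum_nonneg fun i hi => mul_nonneg (hw i hi) (mul_nonneg (hx i hi) (hy i hi))
  refine (Real.rpow_le_rpow hnn key hp.le).trans_eq ?_
  rw [Real.mul_rpow (Real.rpow_nonneg hY _) (Real.rpow_nonneg hX _), ← Real.rpow_mul hY,
    ← Real.rpow_mul hX, one_div_mul_cancel hp.ne', Real.rpow_one, mul_comm]
  congr 2
  rw [one_div_mul_eq_div, hpq.div_conj_eq_sub_one]

lemma sum_midx_shift {n m j : ℕ} (α : MIdx n j) (f : (Fin n → ℕ) → ℝ) :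
    ∑ δ : MIdx n (m + j), (if ∀ i, α.1 i ≤ δ.1 i then f (δ.1 - α.1) else 0) =
      ∑ γ : MIdx n m, f γ.1 := by
  have hadd : ∀ γ : MIdx n m, mdeg (γ.1 + α.1) = m + j := fun γ =>
    Finset.sum_add_distrib.trans (congrArg₂ (· + ·) γ.2 α.2)
  rw [← Finset.sum_filter]
  symm
  refine Finset.sum_bij (fun γ _ => ⟨γ.1 + α.1, hadd γ⟩) ?_ ?_ ?_ ?_
  · intro γ _
    simp
  · intro γ _ γ' _ he
    exact Subtype.ext (add_right_cancel (congrArg Subtype.val he))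
  · intro δ hδ
    have hle : ∀ i, α.1 i ≤ δ.1 i := (Finset.mem_filter.1 hδ).2
    have he : δ.1 - α.1 + α.1 = δ.1 := funext fun i => Nat.sub_add_cancel (hle i)
    have hdeg : mdeg (δ.1 - α.1) = m := by
      rw [mdeg_sub_of_le hle, δ.2, α.2, Nat.add_sub_cancel]
    exact ⟨⟨δ.1 - α.1, hdeg⟩, Finset.mem_univ _, Subtype.ext he⟩
  · intro γ _
    simp

/-- The weight `1/(δ-α)!`, extended by zero to all `δ` not above `α`. -/
def shiftWeight {n : ℕ} (α δ : Fin n → ℕ) : ℝ :=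
  if ∀ i, α i ≤ δ i then 1 / (mfact (δ - α) : ℝ) else 0

lemma shiftWeight_nonneg {n : ℕ} (α δ : Fin n → ℕ) : 0 ≤ shiftWeight α δ := by
  unfold shiftWeight
  positivity

lemma shiftWeight_div_mfact {n : ℕ} (α δ : Fin n → ℕ) :
    shiftWeight α δ / (mfact α : ℝ) = ((∏ i, (δ i).choose (α i) : ℕ) : ℝ) / (mfact δ : ℝ) := by
  unfold shiftWeight
  split_ifs with h
  · have h1 := mfact_ne_zero (K := ℝ) (δ - α)
    have h2 := mfact_ne_zero (K := ℝ) α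
    have h3 : ((∏ i, (δ i).choose (α i) : ℕ) : ℝ) ≠ 0 :=
      Nat.cast_ne_zero.2 (Finset.prod_pos fun i _ => Nat.choose_pos (h i)).ne'
    rw [← prod_choose_mul_mfact h, Nat.cast_mul, Nat.cast_mul]
    field_simp
  · rw [prod_choose_eq_zero h]
    simp

lemma norm_mmul_rpow_le {n n' m k q' : ℕ} {F : Type*} [RCLike F] {ρ ϱ : ℝ}
    (hpq : ρ.HolderConjugate ϱ) (h : Fin n → F) (A : MMat n n' (m + k) q' F)
    (α : MIdx n (0 + k)) (α' : MIdx n' q') :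
    ‖mmul (oprod (fun (z : MIdx n 0) (γ : MIdx n m) =>
        opowRow (rowOf h) m z γ / (m.factorial : F)) (unitMat n k F)) A α α'‖ ^ ρ ≤
      ((∑ i, ‖h i‖ ^ ϱ) ^ m / (m.factorial : ℝ)) ^ (ρ - 1) *
        ∑ δ : MIdx n (m + k), shiftWeight α.1 δ.1 * ‖A δ α'‖ ^ ρ := by
  have hw : ∑ δ : MIdx n (m + k),
      shiftWeight α.1 δ.1 * (∏ i, ‖h i‖ ^ (δ.1 - α.1) i) ^ ϱ =
      (∑ i, ‖h i‖ ^ ϱ) ^ m / (m.factorial : ℝ) := by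
    rw [← sum_midx_pow_div_mfact,
      ← sum_midx_shift (⟨α.1, α.2.trans (zero_add k)⟩ : MIdx n k)
        fun γ => (∏ i, (‖h i‖ ^ ϱ) ^ γ i) / (mfact γ : ℝ)]
    refine Finset.sum_congr rfl fun δ _ => ?_
    unfold shiftWeight
    split_ifs
    · rw [← Real.finsetProd_rpow _ _ fun i _ => by positivity, one_div_mul_eq_div]
      congr 1
      refine Finset.prod_congr rfl fun i _ => ?_
      rw [← Real.rpow_natCast, ← Real.rpow_natCast, ← Real.rpow_mul (norm_nonneg _),
        ← Real.rpow_mul (norm_nonneg _), mul_comm]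
    · rw [zero_mul]
  rw [← hw]
  refine le_trans (Real.rpow_le_rpow (norm_nonneg _) ?_ hpq.nonneg)
    (rpow_sum_weight_mul_le Finset.univ hpq (fun δ _ => shiftWeight_nonneg _ _)
      (fun δ _ => by positivity) fun δ _ => norm_nonneg _)
  refine (norm_sum_le _ _).trans (Finset.sum_le_sum fun δ _ => ?_)
  rw [oprod_opowRow_unitMat, norm_mul, ← mul_assoc]
  refine mul_le_mul_of_nonneg_right (le_of_eq ?_) (norm_nonneg _)
  unfold shiftWeight
  split_ifs
  · rw [norm_div, norm_prod, RCLike.norm_natCast, one_div_mul_eq_div]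
    simp only [norm_pow]
  · simp

/-- For `1 < ρ < ∞` with conjugate exponent `ϱ`, all `m, k, q'`, every row vector
`h ∈ M_{n,n}(0,1;F)` and every `A ∈ M_{n,n'}(m+k,q';F)`:
`‖((h^{(m)}/m!)⊙E_k)A‖_ρ ≤ binom(m+k,k)·‖h‖_ϱ^m·‖A‖_ρ`. -/
theorem rnorm_opow_unit_mmul_le {n n' m k q' : ℕ} {F : Type*} [RCLike F] (hn : 0 < n)
    (hn' : 0 < n') (ρ ϱ : ℝ) (hρ : 1 < ρ) (hconj : 1 / ρ + 1 / ϱ = 1)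
    (h : Fin n → F) (A : MMat n n' (m + k) q' F) :
    rnorm ρ (mmul (oprod (fun (z : MIdx n 0) (γ : MIdx n m) =>
        opowRow (rowOf h) m z γ / (m.factorial : F)) (unitMat n k F)) A) ≤
      ((m + k).choose k : ℝ) * vnorm ϱ h ^ m * rnorm ρ A := by
  have hpq : ρ.HolderConjugate ϱ := Real.holderConjugate_iff.2 ⟨hρ, by simpa using hconj⟩
  have hV : 0 ≤ ∑ i, ‖h i‖ ^ ϱ := Finset.sum_nonneg fun i _ => by positivity
  set V := ∑ i, ‖h i‖ ^ ϱ with hVdef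
  set C : ℝ := ((m + k).choose k : ℝ) with hC
  have hC0 : 0 < C := Nat.cast_pos.2 (Nat.choose_pos (Nat.le_add_left k m))
  set T : ℝ := ∑ δ : MIdx n (m + k), ∑ α' : MIdx n' q', ‖A δ α'‖ ^ ρ /
    ((mfact δ.1 : ℝ) * (((m + k).factorial * q'.factorial : ℕ) : ℝ) ^ (ρ - 1)) with hT
  have hT0 : 0 ≤ T := by positivity
  have hconst : ∀ δ : MIdx n (m + k), (V ^ m / (m.factorial : ℝ)) ^ (ρ - 1) /
      (((0 + k).factorial * q'.factorial : ℕ) : ℝ) ^ (ρ - 1) * (C / (mfact δ.1 : ℝ)) =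
      C ^ ρ * (V ^ m) ^ (ρ - 1) /
        ((mfact δ.1 : ℝ) * (((m + k).factorial * q'.factorial : ℕ) : ℝ) ^ (ρ - 1)) := by
    intro δ
    have h1 : ((m + k).factorial : ℝ) = C * (k.factorial * m.factorial) := by
      rw [hC, ← Nat.choose_mul_factorial_mul_factorial (Nat.le_add_left k m), Nat.add_sub_cancel]
      push_cast
      ring
    have h2 : C ^ ρ = C ^ (ρ - 1) * C := by
      rw [← Real.rpow_add_one hC0.ne', sub_add_cancel]
    have hm : (0 : ℝ) < m.factorial := by positivity
    have hk : (0 : ℝ) < k.factorial := by positivity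
    have hq : (0 : ℝ) < q'.factorial := by positivity
    rw [zero_add, Nat.cast_mul, Nat.cast_mul, h1, h2, Real.div_rpow (by positivity) hm.le,
      Real.mul_rpow hk.le hq.le, Real.mul_rpow (by positivity) hq.le,
      Real.mul_rpow hC0.le (by positivity), Real.mul_rpow hk.le hm.le]
    have := mfact_ne_zero (K := ℝ) δ.1
    have hm' := (Real.rpow_pos_of_pos hm (ρ - 1)).ne'
    have hk' := (Real.rpow_pos_of_pos hk (ρ - 1)).ne'
    have hq' := (Real.rpow_pos_of_pos hq (ρ - 1)).ne'
    have hC' := (Real.rpow_pos_of_pos hC0 (ρ - 1)).ne'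
    field_simp
  have hvand : ∀ δ : MIdx n (m + k),
      ∑ α : MIdx n (0 + k), shiftWeight α.1 δ.1 / (mfact α.1 : ℝ) = C / (mfact δ.1 : ℝ) := by
    intro δ
    simp only [shiftWeight_div_mfact]
    rw [← Finset.sum_div, ← Nat.cast_sum, sum_midx_prod_choose, δ.2, zero_add]
  have hsum : ∑ α : MIdx n (0 + k), ∑ α' : MIdx n' q',
      ‖mmul (oprod (fun (z : MIdx n 0) (γ : MIdx n m) =>
        opowRow (rowOf h) m z γ / (m.factorial : F)) (unitMat n k F)) A α α'‖ ^ ρ /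
        ((mfact α.1 : ℝ) * (((0 + k).factorial * q'.factorial : ℕ) : ℝ) ^ (ρ - 1)) ≤
      C ^ ρ * (V ^ m) ^ (ρ - 1) * T := by
    calc
      _ ≤ ∑ α : MIdx n (0 + k), ∑ α' : MIdx n' q', ∑ δ : MIdx n (m + k),
          (V ^ m / (m.factorial : ℝ)) ^ (ρ - 1) /
            (((0 + k).factorial * q'.factorial : ℕ) : ℝ) ^ (ρ - 1) *
            (shiftWeight α.1 δ.1 / (mfact α.1 : ℝ)) * ‖A δ α'‖ ^ ρ := by
        refine Finset.sum_le_sum fun α _ => Finset.sum_le_sum fun α' _ => ?_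
        refine (div_le_div_of_nonneg_right (norm_mmul_rpow_le hpq h A α α')
          (by positivity)).trans_eq ?_
        rw [Finset.mul_sum, Finset.sum_div]
        refine Finset.sum_congr rfl fun δ _ => ?_
        rw [mul_comm (mfact α.1 : ℝ), ← div_div]
        ring
      _ = ∑ δ : MIdx n (m + k), ∑ α' : MIdx n' q', ∑ α : MIdx n (0 + k),
          (V ^ m / (m.factorial : ℝ)) ^ (ρ - 1) /
            (((0 + k).factorial * q'.factorial : ℕ) : ℝ) ^ (ρ - 1) *
            (shiftWeight α.1 δ.1 / (mfact α.1 : ℝ)) * ‖A δ α'‖ ^ ρ := by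
        rw [Finset.sum_comm]
        simp_rw [Finset.sum_comm (s := (Finset.univ : Finset (MIdx n (0 + k))))]
        rw [Finset.sum_comm]
      _ = C ^ ρ * (V ^ m) ^ (ρ - 1) * T := by
        rw [hT, Finset.mul_sum]
        refine Finset.sum_congr rfl fun δ _ => ?_
        rw [Finset.mul_sum]
        refine Finset.sum_congr rfl fun α' _ => ?_
        rw [← Finset.sum_mul, ← Finset.mul_sum, hvand, hconst]
        ring
  refine (Real.rpow_le_rpow (by positivity) hsum hpq.one_div_nonneg).trans_eq ?_
  have hVm : ((V ^ m) ^ (ρ - 1)) ^ (1 / ρ) = vnorm ϱ h ^ m := by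
    rw [vnorm, ← Real.rpow_mul (by positivity), ← Real.rpow_natCast, ← Real.rpow_natCast,
      ← Real.rpow_mul hV, ← Real.rpow_mul hV, mul_comm (1 / ϱ)]
    congr 2
    rw [one_div ϱ, ← hpq.one_sub_inv]
    have := hpq.ne_zero
    field_simp
  rw [Real.mul_rpow (by positivity) hT0, Real.mul_rpow (by positivity) (by positivity), hVm,
    ← Real.rpow_mul hC0.le, mul_one_div_cancel hpq.ne_zero, Real.rpow_one, rnorm]

end
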